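/- Let φ be a solution of the spectral collocation approximation of the elasticity system, and set X = ∫_Ω φ_t·(m_j ∂φ/∂x_j) dx evaluated at t = T minus the same quantity at t = 0, and Y = ∫_Ω φ_t·φ dx evaluated at t = T minus the same quantity at t = 0, where m(x) = x − (−1,…,−1) and a repeated index j denotes summation over j = 1,…,d. Then |X + ((d−1)/2)·Y| ≤ (4√d/√μ)·E(0). -/

import Mathlib

open MeasureTheory Polynomial Finset
open scoped Classical

noncomputable section

/-- Points of `ℝ^d`. -/
abbrev Vec (d : ℕ) := Fin d → ℝ

/-- The open cube `Ω = (-1,1)^d`. -/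
def cubeO (d : ℕ) : Set (Vec d) := Set.univ.pi fun _ => Set.Ioo (-1 : ℝ) 1

/-- The closed cube `cl(Ω) = [-1,1]^d`. -/
def cubeC (d : ℕ) : Set (Vec d) := Set.univ.pi fun _ => Set.Icc (-1 : ℝ) 1

/-- The boundary `∂Ω` of the cube. -/
def cubeB (d : ℕ) : Set (Vec d) := cubeC d \ cubeO d

/-- The Legendre polynomial `L_N` via Rodrigues' formula. -/
def legendre (N : ℕ) : Polynomial ℝ :=
  C (1 / (2 ^ N * (N.factorial : ℝ))) * derivative^[N] ((X ^ 2 - 1) ^ N)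

/-- `nd` is the increasing enumeration of the `N+1` Legendre–Gauss–Lobatto nodes,
which are exactly the roots of `(1 - x²) L_N'(x)`. -/
def IsLGL (N : ℕ) (nd : Fin (N + 1) → ℝ) : Prop :=
  StrictMono nd ∧ nd 0 = -1 ∧ nd (Fin.last N) = 1 ∧
    ∀ x : ℝ, (1 - x ^ 2) * (derivative (legendre N)).eval x = 0 ↔ ∃ k, nd k = x

/-- `Ψ` is the family of Lagrange basis polynomials of degree `N` at the nodes `nd`. -/
def IsLagrange (N : ℕ) (nd : Fin (N + 1) → ℝ) (Ψ : Fin (N + 1) → Polynomial ℝ) : Prop :=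
  ∀ k, (Ψ k).natDegree ≤ N ∧ ∀ m, (Ψ k).eval (nd m) = if m = k then 1 else 0

/-- The LGL quadrature weight `ω_k = ∫_{-1}^1 Ψ_k`. -/
def lglW (N : ℕ) (Ψ : Fin (N + 1) → Polynomial ℝ) (k : Fin (N + 1)) : ℝ :=
  ∫ x in (-1 : ℝ)..(1 : ℝ), (Ψ k).eval x

/-- The tensor-product collocation node `P_i` associated with a multi-index. -/
def nodeP {N d : ℕ} (nd : Fin (N + 1) → ℝ) (k : Fin d → Fin (N + 1)) : Vec d :=
  fun j => nd (k j)

/-- `p : ℝ^d → ℝ` is (the function associated with) a polynomial of degree at most `N`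
in each of the `d` variables, i.e. a member of `P_N(Ω)`. -/
def MemPolyN (d N : ℕ) (p : Vec d → ℝ) : Prop :=
  ∃ q : MvPolynomial (Fin d) ℝ, (∀ j, q.degreeOf j ≤ N) ∧ ∀ x, MvPolynomial.eval x q = p x

/-- Membership in `P_N^{Di}(Ω)`: a polynomial of degree `≤ N` in each variable vanishing
on `∂Ω`. -/
def MemPolyDi (d N : ℕ) (p : Vec d → ℝ) : Prop :=
  MemPolyN d N p ∧ ∀ x ∈ cubeB d, p x = 0

/-- Partial derivative `∂f/∂x_j`. -/
def pd {d : ℕ} (j : Fin d) (f : Vec d → ℝ) (x : Vec d) : ℝ :=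
  fderiv ℝ f x (Pi.single j 1)

/-- Divergence of a vector field. -/
def vdiv {d : ℕ} (v : Vec d → Fin d → ℝ) (x : Vec d) : ℝ :=
  ∑ j, pd j (fun y => v y j) x

/-- The elasticity operator `Δ* = μΔ + (λ+μ)∇div` acting on vector fields. -/
def elast {d : ℕ} (lam mu : ℝ) (v : Vec d → Fin d → ℝ) (x : Vec d) (i : Fin d) : ℝ :=
  mu * ∑ j, pd j (pd j fun y => v y i) x + (lam + mu) * pd i (vdiv v) x

/-- Time derivative of a time-dependent vector field. -/
def tderiv {d : ℕ} (φ : ℝ → Vec d → Fin d → ℝ) : ℝ → Vec d → Fin d → ℝ :=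
  fun t x i => deriv (fun s => φ s x i) t

/-- `φ` is a solution of the spectral collocation approximation of the elasticity system:
`φ ∈ C^∞([0,T]; P_N(Ω)^d)`, `φ_tt(t,P_i) = Δ*φ(t,P_i)` at interior collocation nodes and
`φ(t,P_i) = 0` at boundary collocation nodes. -/
def IsColloc (d N : ℕ) (lam mu T : ℝ) (nd : Fin (N + 1) → ℝ)
    (φ : ℝ → Vec d → Fin d → ℝ) : Prop :=
  (∀ x i, ContDiff ℝ (⊤ : ℕ∞) fun t => φ t x i) ∧
  (∀ t ∈ Set.Icc (0 : ℝ) T, ∀ i, MemPolyN d N fun x => φ t x i) ∧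
  (∀ t ∈ Set.Icc (0 : ℝ) T, ∀ k : Fin d → Fin (N + 1), nodeP nd k ∈ cubeO d →
    ∀ i, tderiv (tderiv φ) t (nodeP nd k) i = elast lam mu (φ t) (nodeP nd k) i) ∧
  (∀ t ∈ Set.Icc (0 : ℝ) T, ∀ k : Fin d → Fin (N + 1), nodeP nd k ∈ cubeB d →
    ∀ i, φ t (nodeP nd k) i = 0)

/-- The discrete (LGL) inner product `(w,z)_N = Σ_i ω_i w(P_i) z(P_i)`. -/
def dInner (N d : ℕ) (nd : Fin (N + 1) → ℝ) (Ψ : Fin (N + 1) → Polynomial ℝ)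
    (w z : Vec d → ℝ) : ℝ :=
  ∑ k : Fin d → Fin (N + 1), (∏ j, lglW N Ψ (k j)) * (w (nodeP nd k) * z (nodeP nd k))

/-- The discrete energy
`E(t) = ½(‖φ_t‖_N² + μ‖∇φ‖_N² + (λ+μ)‖div φ‖_N²)` of a collocation solution. -/
def dEnergy (d N : ℕ) (lam mu : ℝ) (nd : Fin (N + 1) → ℝ) (Ψ : Fin (N + 1) → Polynomial ℝ)
    (φ : ℝ → Vec d → Fin d → ℝ) (t : ℝ) : ℝ :=
  (1 / 2) * ((∑ i, dInner N d nd Ψ (fun x => tderiv φ t x i) fun x => tderiv φ t x i) +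
    mu * ∑ i, ∑ j, dInner N d nd Ψ (pd j fun y => φ t y i) (pd j fun y => φ t y i) +
    (lam + mu) * dInner N d nd Ψ (vdiv (φ t)) (vdiv (φ t)))

/-- Surface integral over the face `{x ∈ ∂Ω : x_j = c}` (with `c = ±1`) of the cube:
the integrand does not depend on the `j`-th variable after the substitution, so the
integral over the full cube divided by `2` is exactly the `(d-1)`-dimensional integral. -/
def faceInt (d : ℕ) (j : Fin d) (c : ℝ) (f : Vec d → ℝ) : ℝ :=
  (1 / 2) * ∫ x in cubeC d, f (Function.update x j c)

/-- The `i`-th component of `μ ∂v/∂ν + (λ+μ) ν div v` on the face with outward normal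
`ν = c·e_j`. -/
def obs1 {d : ℕ} (lam mu : ℝ) (v : Vec d → Fin d → ℝ) (j : Fin d) (c : ℝ) (x : Vec d)
    (i : Fin d) : ℝ :=
  mu * (c * pd j (fun y => v y i) x) +
    (lam + mu) * (c * if i = j then 1 else 0) * vdiv v x

/-- The `i`-th component of `μ ∂²v/∂ν² + (λ+μ) ν ∂(div v)/∂ν` on the face with outward
normal `ν = c·e_j`. -/
def obs2 {d : ℕ} (lam mu : ℝ) (v : Vec d → Fin d → ℝ) (j : Fin d) (c : ℝ) (x : Vec d)
    (i : Fin d) : ℝ :=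
  mu * (c * (c * pd j (pd j fun y => v y i) x)) +
    (lam + mu) * (c * if i = j then 1 else 0) * (c * pd j (vdiv v) x)


theorem intervalIntegrable_eval (p : ℝ[X]) (a b : ℝ) :
    IntervalIntegrable (fun x => p.eval x) volume a b :=
  p.continuous.intervalIntegrable a b

theorem integral_eval_derivative (p : ℝ[X]) :
    ∫ x in (-1 : ℝ)..1, (derivative p).eval x = p.eval 1 - p.eval (-1) :=
  intervalIntegral.integral_eq_sub_of_hasDerivAt (fun x _ => p.hasDerivAt x)
    (intervalIntegrable_eval _ _ _)

theorem integral_eval_add (p q : ℝ[X]) :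
    ∫ x in (-1 : ℝ)..1, (p + q).eval x =
      (∫ x in (-1 : ℝ)..1, p.eval x) + ∫ x in (-1 : ℝ)..1, q.eval x := by
  simp only [eval_add]
  exact intervalIntegral.integral_add (intervalIntegrable_eval _ _ _)
    (intervalIntegrable_eval _ _ _)

theorem integral_derivative_mul (p q : ℝ[X]) (h1 : (p * q).eval 1 = 0)
    (h2 : (p * q).eval (-1) = 0) :
    ∫ x in (-1 : ℝ)..1, (derivative p * q).eval x =
      -∫ x in (-1 : ℝ)..1, (p * derivative q).eval x := by
  have h := integral_eval_derivative (p * q)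
  rw [derivative_mul, integral_eval_add, h1, h2] at h
  linarith

theorem integral_iterate_derivative_mul_eq_zero (N : ℕ) :
    ∀ k ≤ N, ∀ q : ℝ[X], derivative^[k] q = 0 →
      ∫ x in (-1 : ℝ)..1, (derivative^[k] ((X ^ 2 - 1 : ℝ[X]) ^ N) * q).eval x = 0 := by
  intro k
  induction k with
  | zero => intro _ q hq; simp only [Function.iterate_zero, id] at hq; simp [hq]
  | succ k ih =>
    intro hk q hq
    have hroot : ∀ y : ℝ, y ^ 2 = 1 →
        (derivative^[k] ((X ^ 2 - 1 : ℝ[X]) ^ N) * q).eval y = 0 := by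
      intro y hy
      obtain ⟨r, hr⟩ := pow_sub_dvd_iterate_derivative_pow (X ^ 2 - 1 : ℝ[X]) N k
      have : N - k ≠ 0 := by omega
      simp [hr, hy, this]
    rw [Function.iterate_succ_apply', integral_derivative_mul _ _ (hroot _ (by norm_num))
      (hroot _ (by norm_num)), ih (by omega) _ (by simpa using hq), neg_zero]

theorem integral_legendre_mul_eq_zero (N : ℕ) (q : ℝ[X]) (hq : q.natDegree < N) :
    ∫ x in (-1 : ℝ)..1, (legendre N * q).eval x = 0 := by
  have h := integral_iterate_derivative_mul_eq_zero N N le_rfl q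
    (iterate_derivative_eq_zero hq)
  simp only [legendre, mul_assoc, eval_mul, eval_C] at h ⊢
  rw [intervalIntegral.integral_const_mul, h, mul_zero]

/-- The polynomial `(1 - x²) L_N'(x)` whose roots are the LGL nodes. -/
def lobatto (N : ℕ) : ℝ[X] := (1 - X ^ 2) * derivative (legendre N)

theorem integral_lobatto_mul_eq_zero (N : ℕ) (q : ℝ[X]) (hq : q.natDegree + 1 < N) :
    ∫ x in (-1 : ℝ)..1, (lobatto N * q).eval x = 0 := by
  have h := integral_derivative_mul (legendre N) ((1 - X ^ 2) * q) (by simp) (by simp)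
  rw [integral_legendre_mul_eq_zero] at h
  · rw [← neg_zero, ← h]; congr 1; ext x; simp [lobatto]; ring
  · have h1 : (1 - X ^ 2 : ℝ[X]).natDegree ≤ 2 := by compute_degree
    have h2 := natDegree_derivative_le ((1 - X ^ 2 : ℝ[X]) * q)
    have h3 := natDegree_mul_le (p := (1 - X ^ 2 : ℝ[X])) (q := q)
    omega

theorem natDegree_legendre_le (N : ℕ) : (legendre N).natDegree ≤ N := by
  have h1 : ((X ^ 2 - 1 : ℝ[X]) ^ N).natDegree ≤ N * 2 :=
    natDegree_pow_le_of_le N (by compute_degree)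
  have h2 := natDegree_iterate_derivative ((X ^ 2 - 1 : ℝ[X]) ^ N) N
  exact (natDegree_C_mul_le _ _).trans (by omega)

theorem eq_sum_lagrange {N : ℕ} {nd : Fin (N + 1) → ℝ} {Ψ : Fin (N + 1) → ℝ[X]}
    (hnd : Function.Injective nd) (hΨ : IsLagrange N nd Ψ) (p : ℝ[X]) (hp : p.natDegree ≤ N) :
    p = ∑ k, C (p.eval (nd k)) * Ψ k := by
  refine eq_of_degrees_lt_of_eval_index_eq (Finset.univ : Finset (Fin (N + 1)))
    (hnd.injOn) ?_ ?_ ?_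
  · rw [Finset.card_univ, Fintype.card_fin]
    exact lt_of_le_of_lt (degree_le_of_natDegree_le hp) (by exact_mod_cast Nat.lt_succ_self N)
  · rw [Finset.card_univ, Fintype.card_fin]
    refine lt_of_le_of_lt (degree_le_of_natDegree_le (n := N) ?_)
      (by exact_mod_cast Nat.lt_succ_self N)
    exact natDegree_sum_le_of_forall_le _ _ fun k _ => (natDegree_C_mul_le _ _).trans (hΨ k).1
  · intro m _
    simp [eval_finsetSum, (hΨ _).2]

theorem integral_eq_sum_lglW_of_natDegree_le {N : ℕ} {nd : Fin (N + 1) → ℝ}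
    {Ψ : Fin (N + 1) → ℝ[X]} (hnd : Function.Injective nd) (hΨ : IsLagrange N nd Ψ) (p : ℝ[X])
    (hp : p.natDegree ≤ N) :
    ∫ x in (-1 : ℝ)..1, p.eval x = ∑ k, lglW N Ψ k * p.eval (nd k) := by
  conv_lhs => rw [eq_sum_lagrange hnd hΨ p hp]
  simp only [eval_finsetSum, eval_mul, eval_C]
  rw [intervalIntegral.integral_finsetSum
    fun k _ => (intervalIntegrable_eval (Ψ k) _ _).const_mul _]
  refine Finset.sum_congr rfl fun k _ => ?_
  rw [intervalIntegral.integral_const_mul, lglW, mul_comm]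

theorem lobatto_eval_node {N : ℕ} {nd : Fin (N + 1) → ℝ} (hnd : IsLGL N nd)
    (k : Fin (N + 1)) : (lobatto N).eval (nd k) = 0 := by
  simpa [lobatto] using (hnd.2.2.2 (nd k)).2 ⟨k, rfl⟩

theorem lobatto_ne_zero {N : ℕ} {nd : Fin (N + 1) → ℝ} (hnd : IsLGL N nd) : lobatto N ≠ 0 := by
  intro h
  have : Set.range nd = Set.univ := Set.eq_univ_of_forall fun x =>
    (hnd.2.2.2 x).1 (by simpa [lobatto] using congrArg (eval x) h)
  exact Set.infinite_univ (this ▸ Set.finite_range nd)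

theorem natDegree_lobatto {N : ℕ} {nd : Fin (N + 1) → ℝ} (hN : 2 ≤ N) (hnd : IsLGL N nd) :
    (lobatto N).natDegree = N + 1 := by
  apply le_antisymm
  · have h1 : (1 - X ^ 2 : ℝ[X]).natDegree ≤ 2 := by compute_degree
    have h2 := natDegree_derivative_le (legendre N)
    have h3 := natDegree_mul_le (p := (1 - X ^ 2 : ℝ[X])) (q := derivative (legendre N))
    have h4 := natDegree_legendre_le N
    unfold lobatto
    omega
  · by_contra! hlt
    refine lobatto_ne_zero hnd (eq_zero_of_natDegree_lt_card_of_eval_eq_zero _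
      hnd.1.injective (lobatto_eval_node hnd) (by simpa using hlt))

/-- The LGL quadrature is exact in degree at most `2N - 1`. -/
theorem integral_eq_sum_lglW {N : ℕ} {nd : Fin (N + 1) → ℝ} {Ψ : Fin (N + 1) → ℝ[X]}
    (hN : 2 ≤ N) (hnd : IsLGL N nd) (hΨ : IsLagrange N nd Ψ) (p : ℝ[X])
    (hp : p.natDegree < 2 * N) :
    ∫ x in (-1 : ℝ)..1, p.eval x = ∑ k, lglW N Ψ k * p.eval (nd k) := by
  have hW := natDegree_lobatto hN hnd
  have hmod : (p % lobatto N).natDegree ≤ N := by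
    have := natDegree_mod_lt p (q := lobatto N) (by omega)
    omega
  have hdiv : (p / lobatto N).natDegree + 1 < N := by
    by_cases h0 : p / lobatto N = 0
    · rw [h0, natDegree_zero]; omega
    · have h1 : lobatto N * (p / lobatto N) = p - p % lobatto N :=
        eq_sub_of_add_eq (EuclideanDomain.div_add_mod p (lobatto N))
      have h2 := congrArg natDegree h1
      rw [natDegree_mul (lobatto_ne_zero hnd) h0, hW] at h2
      have h3 := natDegree_sub_le_of_le (m := 2 * N - 1) (show p.natDegree ≤ _ by omega)
        (hmod.trans (show N ≤ 2 * N - 1 by omega))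
      rw [max_self] at h3
      omega
  have key := EuclideanDomain.div_add_mod p (lobatto N)
  conv_lhs => rw [← key]
  rw [integral_eval_add, integral_lobatto_mul_eq_zero N _ hdiv, zero_add,
    integral_eq_sum_lglW_of_natDegree_le hnd.1.injective hΨ _ hmod]
  refine Finset.sum_congr rfl fun k _ => ?_
  conv_rhs => rw [← key]
  simp [lobatto_eval_node hnd]

/-- The discrete LGL norm dominates the `L²` norm in degree at most `N`. -/
theorem integral_sq_le_sum_lglW {N : ℕ} {nd : Fin (N + 1) → ℝ} {Ψ : Fin (N + 1) → ℝ[X]}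
    (hN : 2 ≤ N) (hnd : IsLGL N nd) (hΨ : IsLagrange N nd Ψ) (p : ℝ[X]) (hp : p.natDegree ≤ N) :
    ∫ x in (-1 : ℝ)..1, (p ^ 2).eval x ≤ ∑ k, lglW N Ψ k * (p ^ 2).eval (nd k) := by
  set D := derivative (legendre N) with hD
  have hlob : lobatto N = (1 - X ^ 2) * D := rfl
  have hD0 : D ≠ 0 := fun h => lobatto_ne_zero hnd (by rw [hlob, h, mul_zero])
  have h2 : (1 - X ^ 2 : ℝ[X]).natDegree = 2 := by
    compute_degree!
  have hDdeg : D.natDegree = N - 1 := by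
    have h := natDegree_lobatto hN hnd
    rw [hlob, natDegree_mul (fun h => by simp [h] at h2) hD0, h2] at h
    omega
  set b := p.coeff N / D.leadingCoeff with hb
  set r := p ^ 2 + C (b ^ 2) * ((1 - X ^ 2) * D ^ 2) with hr
  have hrdeg : r.natDegree < 2 * N := by
    have hle : r.natDegree ≤ 2 * N := by
      refine natDegree_add_le_of_degree_le (natDegree_pow_le_of_le 2 hp)
        ((natDegree_C_mul_le _ _).trans (natDegree_mul_le.trans ?_))
      rw [h2, natDegree_pow, hDdeg]
      omega
    have hc : r.coeff (2 * N) = 0 := by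
      have e1 : (p ^ 2).coeff (2 * N) = p.coeff N ^ 2 := coeff_pow_of_natDegree_le hp
      have e2 : ((1 - X ^ 2 : ℝ[X]) * D ^ 2).coeff (2 + 2 * (N - 1)) =
          (1 - X ^ 2 : ℝ[X]).coeff 2 * (D ^ 2).coeff (2 * (N - 1)) :=
        coeff_mul_add_eq_of_natDegree_le h2.le (natDegree_pow_le_of_le 2 hDdeg.le)
      have e3 : (D ^ 2).coeff (2 * (N - 1)) = D.coeff (N - 1) ^ 2 :=
        coeff_pow_of_natDegree_le hDdeg.le
      have e4 : D.coeff (N - 1) = D.leadingCoeff := by rw [leadingCoeff, hDdeg]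
      have e5 : (1 - X ^ 2 : ℝ[X]).coeff 2 = -1 := by simp [coeff_one]
      have e6 : 2 + 2 * (N - 1) = 2 * N := by omega
      rw [e6] at e2
      have hlc : D.leadingCoeff ≠ 0 := leadingCoeff_ne_zero.2 hD0
      rw [hr, coeff_add, coeff_C_mul, e1, e2, e3, e4, e5, hb]
      field_simp
      ring
    refine lt_of_le_of_ne hle fun h => ?_
    have : r = 0 := by rw [← leadingCoeff_eq_zero, leadingCoeff, h, hc]
    rw [this] at h
    simp at h
    omega
  have hex := integral_eq_sum_lglW hN hnd hΨ r hrdeg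
  have hnode : ∀ k, r.eval (nd k) = (p ^ 2).eval (nd k) := by
    intro k
    have := lobatto_eval_node hnd k
    rw [hlob, eval_mul] at this
    simp only [hr, eval_add, eval_mul, eval_pow] at this ⊢
    rw [pow_two (eval (nd k) D), ← mul_assoc (eval (nd k) (1 - X ^ 2)), this]
    ring
  simp only [hnode] at hex
  rw [← hex]
  refine intervalIntegral.integral_mono_on (by norm_num) (intervalIntegrable_eval _ _ _)
    (intervalIntegrable_eval _ _ _) fun x hx => ?_
  have hx2 : 0 ≤ 1 - x ^ 2 := by nlinarith [hx.1, hx.2]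
  simp only [hr, eval_add, eval_mul, eval_C, eval_pow, eval_sub, eval_one, eval_X]
  have : 0 ≤ b ^ 2 * ((1 - x ^ 2) * eval x D ^ 2) := by positivity
  linarith

theorem lglW_nonneg {N : ℕ} {nd : Fin (N + 1) → ℝ} {Ψ : Fin (N + 1) → ℝ[X]}
    (hN : 2 ≤ N) (hnd : IsLGL N nd) (hΨ : IsLagrange N nd Ψ) (k : Fin (N + 1)) :
    0 ≤ lglW N Ψ k := by
  have h := integral_sq_le_sum_lglW hN hnd hΨ (Ψ k) (hΨ k).1
  have h0 : 0 ≤ ∫ x in (-1 : ℝ)..1, (Ψ k ^ 2).eval x :=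
    intervalIntegral.integral_nonneg (by norm_num) fun x _ => by
      rw [eval_pow]; positivity
  simp only [eval_pow, (hΨ k).2] at h h0
  simp at h
  linarith

theorem MvPolynomial.differentiable_eval {d : ℕ} (q : MvPolynomial (Fin d) ℝ) :
    Differentiable ℝ fun x : Vec d => MvPolynomial.eval x q := by
  induction q using MvPolynomial.induction_on with
  | C a => simp
  | add p q hp hq =>
    simp only [map_add]
    exact hp.fun_add hq
  | mul_X p i hp =>
    simp only [map_mul, MvPolynomial.eval_X]
    exact hp.mul (differentiable_apply i)

theorem pd_eval {d : ℕ} (j : Fin d) (q : MvPolynomial (Fin d) ℝ) :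
    (pd j fun x => MvPolynomial.eval x q) =
      fun x => MvPolynomial.eval x (MvPolynomial.pderiv j q) := by
  funext x
  induction q using MvPolynomial.induction_on with
  | C a => simp [pd]
  | add p q hp hq =>
    simp only [pd, map_add] at hp hq ⊢
    rw [fderiv_fun_add (p.differentiable_eval x) (q.differentiable_eval x)]
    simp [hp, hq]
  | mul_X p i hp =>
    simp only [pd, map_mul, MvPolynomial.eval_X] at hp ⊢
    rw [fderiv_fun_mul (p.differentiable_eval x) (differentiable_apply i x)]
    have : fderiv ℝ (fun y : Vec d => y i) x = ContinuousLinearMap.proj i :=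
      (ContinuousLinearMap.proj (R := ℝ) (φ := fun _ : Fin d => ℝ) i).fderiv
    simp [hp, this, Pi.single_apply, MvPolynomial.pderiv_X, mul_comm]
    aesop

/-- The restriction of `q` to the line through `x` in the direction `e_j`. -/
def lineSlice {d : ℕ} (x : Vec d) (j : Fin d) (q : MvPolynomial (Fin d) ℝ) : ℝ[X] :=
  MvPolynomial.aeval (Function.update (fun i => C (x i)) j X) q

theorem eval_lineSlice {d : ℕ} (x : Vec d) (j : Fin d) (q : MvPolynomial (Fin d) ℝ) (t : ℝ) :
    (lineSlice x j q).eval t = MvPolynomial.eval (Function.update x j t) q := by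
  unfold lineSlice
  induction q using MvPolynomial.induction_on with
  | C a => simp
  | add p q hp hq => simp [hp, hq]
  | mul_X p i hp =>
    rw [map_mul, eval_mul, hp, map_mul, MvPolynomial.aeval_X, MvPolynomial.eval_X]
    by_cases h : i = j <;> simp [h]

theorem lineSlice_pderiv {d : ℕ} (x : Vec d) (j : Fin d) (q : MvPolynomial (Fin d) ℝ) :
    lineSlice x j (MvPolynomial.pderiv j q) = derivative (lineSlice x j q) := by
  unfold lineSlice
  induction q using MvPolynomial.induction_on with
  | C a => simp
  | add p q hp hq => simp [hp, hq]
  | mul_X p i hp =>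
    rw [MvPolynomial.pderiv_mul, map_add, map_mul, map_mul, map_mul, derivative_mul, hp,
      MvPolynomial.aeval_X]
    by_cases h : i = j
    · simp [h]
    · simp [h, MvPolynomial.pderiv_X_of_ne h]

theorem natDegree_lineSlice_le {d : ℕ} (x : Vec d) (j : Fin d) (q : MvPolynomial (Fin d) ℝ) :
    (lineSlice x j q).natDegree ≤ q.degreeOf j := by
  unfold lineSlice
  rw [MvPolynomial.aeval_def, MvPolynomial.eval₂_eq']
  refine natDegree_sum_le_of_forall_le _ _ fun s hs => ?_
  rw [← C_eq_algebraMap]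
  refine (natDegree_C_mul_le _ _).trans ((natDegree_prod_le _ _).trans ?_)
  refine le_trans ?_ (MvPolynomial.le_degreeOf_of_mem_support j hs)
  rw [← Finset.add_sum_erase _ _ (Finset.mem_univ j)]
  rw [Finset.sum_eq_zero]
  · simp
  · intro i hi
    simp [Finset.ne_of_mem_erase hi]

theorem degreeOf_pderiv_le {d : ℕ} (i j : Fin d) (q : MvPolynomial (Fin d) ℝ) :
    (MvPolynomial.pderiv i q).degreeOf j ≤ q.degreeOf j := by
  rw [MvPolynomial.degreeOf_le_iff]
  intro m hm
  have h : q.coeff (m + Finsupp.single i 1) ≠ 0 := by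
    rw [MvPolynomial.mem_support_iff, MvPolynomial.coeff_pderiv] at hm
    exact fun h => hm (by rw [h]; simp)
  have := MvPolynomial.le_degreeOf_of_mem_support j (MvPolynomial.mem_support_iff.2 h)
  rw [Finsupp.add_apply] at this
  omega

/-- Integral of a polynomial against a product measure. -/
def polyInt {d : ℕ} (α : Fin d → Measure ℝ) (q : MvPolynomial (Fin d) ℝ) : ℝ :=
  ∫ x, MvPolynomial.eval x q ∂Measure.pi α

/-- A finite measure on the line against which polynomials are integrable. -/
structure HasMoments (α : Measure ℝ) : Prop where
  finite : IsFiniteMeasure α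
  integrable : ∀ p : ℝ[X], Integrable (fun x => p.eval x) α

section PolyInt

variable {d : ℕ} {α β : Fin d → Measure ℝ}

theorem integrable_eval (hα : ∀ i, HasMoments (α i)) (q : MvPolynomial (Fin d) ℝ) :
    Integrable (fun x => MvPolynomial.eval x q) (Measure.pi α) := by
  have := fun i => (hα i).finite
  simp only [MvPolynomial.eval_eq']
  refine integrable_finsetSum _ fun s _ => Integrable.const_mul ?_ _
  refine Integrable.fintype_prod (f := fun i y => y ^ s i) fun i => ?_
  simpa using (hα i).integrable (X ^ s i)

theorem polyInt_add (hα : ∀ i, HasMoments (α i)) (p q : MvPolynomial (Fin d) ℝ) :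
    polyInt α (p + q) = polyInt α p + polyInt α q := by
  simp only [polyInt, map_add]
  exact integral_add (integrable_eval hα p) (integrable_eval hα q)

theorem polyInt_C_mul (c : ℝ) (q : MvPolynomial (Fin d) ℝ) :
    polyInt α (MvPolynomial.C c * q) = c * polyInt α q := by
  simp [polyInt, integral_const_mul]

theorem polyInt_sum (hα : ∀ i, HasMoments (α i)) {ι : Type*} (s : Finset ι)
    (f : ι → MvPolynomial (Fin d) ℝ) : polyInt α (∑ i ∈ s, f i) = ∑ i ∈ s, polyInt α (f i) := by
  simp only [polyInt, map_sum]
  exact integral_finsetSum _ fun i _ => integrable_eval hα (f i)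

/-- Fubini's theorem comparing two product measures that differ in a single coordinate. -/
theorem polyInt_mono_coord (hα : ∀ i, HasMoments (α i)) (hβ : ∀ i, HasMoments (β i)) (j : Fin d)
    (hαβ : ∀ i ≠ j, α i = β i) (p q : MvPolynomial (Fin d) ℝ)
    (h : ∀ x, ∫ t, (lineSlice x j p).eval t ∂α j ≤ ∫ t, (lineSlice x j q).eval t ∂β j) :
    polyInt α p ≤ polyInt β q := by
  have := fun i => (hα i).finite
  have := fun i => (hβ i).finite
  obtain ⟨n, rfl⟩ : ∃ n, d = n + 1 := ⟨d - 1, by have := j.pos; omega⟩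
  have fub : ∀ (γ : Fin (n + 1) → Measure ℝ) (_ : ∀ i, HasMoments (γ i))
      (_ : ∀ i, IsFiniteMeasure (γ i)) (r : MvPolynomial (Fin (n + 1)) ℝ),
      Integrable (fun y : Fin n → ℝ =>
        ∫ t, (lineSlice (Fin.insertNth j 0 y) j r).eval t ∂γ j)
        (Measure.pi fun i => γ (j.succAbove i)) ∧
      polyInt γ r = ∫ y : Fin n → ℝ, ∫ t, (lineSlice (Fin.insertNth j 0 y) j r).eval t ∂γ j
        ∂(Measure.pi fun i => γ (j.succAbove i)) := by
    intro γ hγ _ r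
    have mp := (measurePreserving_piFinSuccAbove γ j).symm
    have hint : Integrable (fun z : ℝ × (Fin n → ℝ) =>
        (lineSlice (Fin.insertNth j 0 z.2) j r).eval z.1)
        ((γ j).prod (Measure.pi fun i => γ (j.succAbove i))) := by
      have := (mp.integrable_comp_emb (MeasurableEquiv.measurableEmbedding _)).2
        (integrable_eval hγ r)
      refine this.congr (Filter.Eventually.of_forall fun z => ?_)
      simp [eval_lineSlice, Fin.insertNthEquiv, Fin.update_insertNth]
    refine ⟨hint.integral_prod_right, ?_⟩
    rw [← integral_prod_symm _ hint, polyInt,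
      ← mp.integral_comp (MeasurableEquiv.measurableEmbedding _)]
    refine integral_congr_ae (Filter.Eventually.of_forall fun z => ?_)
    simp [eval_lineSlice, Fin.insertNthEquiv, Fin.update_insertNth]
  rw [(fub α hα inferInstance p).2, (fub β hβ inferInstance q).2]
  have hm : (fun i => α (j.succAbove i)) = fun i => β (j.succAbove i) :=
    funext fun i => hαβ _ (Fin.succAbove_ne j i)
  have h1 := (fub α hα inferInstance p).1
  have h2 := (fub β hβ inferInstance q).1
  rw [hm] at h1 ⊢
  exact integral_mono h1 h2 fun y => h _

theorem polyInt_zero : polyInt α 0 = 0 := by simp [polyInt]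

theorem polyInt_eq_zero_of_slice (hα : ∀ i, HasMoments (α i)) (j : Fin d)
    (q : MvPolynomial (Fin d) ℝ) (h : ∀ x, ∫ t, (lineSlice x j q).eval t ∂α j = 0) :
    polyInt α q = 0 := by
  apply le_antisymm
  · simpa only [polyInt_zero] using
      polyInt_mono_coord hα hα j (fun _ _ => rfl) q 0 fun x => by rw [h]; simp [lineSlice]
  · simpa only [polyInt_zero] using
      polyInt_mono_coord hα hα j (fun _ _ => rfl) 0 q fun x => by rw [h]; simp [lineSlice]

/-- If one-dimensional integration satisfies `∫ p ≤ ∫' p` on squares of polynomials of degree at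
most `N`, so do the product measures. -/
theorem polyInt_sq_le {μ ν : Measure ℝ} (hμ : HasMoments μ) (hν : HasMoments ν) (N : ℕ)
    (h : ∀ p : ℝ[X], p.natDegree ≤ N → ∫ t, (p ^ 2).eval t ∂μ ≤ ∫ t, (p ^ 2).eval t ∂ν)
    (q : MvPolynomial (Fin d) ℝ) (hq : ∀ j, q.degreeOf j ≤ N) :
    polyInt (fun _ => μ) (q ^ 2) ≤ polyInt (fun _ => ν) (q ^ 2) := by
  have key : ∀ s : Finset (Fin d),
      polyInt (fun _ => μ) (q ^ 2) ≤ polyInt (fun i => if i ∈ s then ν else μ) (q ^ 2) := by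
    intro s
    induction s using Finset.induction_on with
    | empty => simp
    | insert j s hj ih =>
      have hs : ∀ (s : Finset (Fin d)) (i : Fin d), HasMoments (if i ∈ s then ν else μ) := by
        intro s i; split_ifs <;> assumption
      refine ih.trans (polyInt_mono_coord (hs s) (hs _) j (fun i hi => ?_) _ _ fun x => ?_)
      · simp [hi]
      · have : lineSlice x j (q ^ 2) = lineSlice x j q ^ 2 := map_pow _ _ _
        simp only [this, hj, if_false, Finset.mem_insert_self, if_true]
        exact h _ ((natDegree_lineSlice_le x j q).trans (hq j))
  simpa using key Finset.univ

end PolyInt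

/-- Lebesgue measure on `(-1, 1)`. -/
def unitMeasure : Measure ℝ := volume.restrict (Set.Ioo (-1) 1)

theorem hasMoments_unitMeasure : HasMoments unitMeasure where
  finite := by unfold unitMeasure; infer_instance
  integrable p := (p.continuous.integrableOn_Icc (a := -1) (b := 1)).mono_set
    Set.Ioo_subset_Icc_self

theorem integral_unitMeasure (f : ℝ → ℝ) :
    ∫ t, f t ∂unitMeasure = ∫ t in (-1 : ℝ)..1, f t := by
  rw [intervalIntegral.integral_of_le (by norm_num), integral_Ioc_eq_integral_Ioo, unitMeasure]

/-- The discrete measure of the LGL quadrature. -/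
def lglMeasure (N : ℕ) (nd : Fin (N + 1) → ℝ) (Ψ : Fin (N + 1) → ℝ[X]) : Measure ℝ :=
  ∑ k, ENNReal.ofReal (lglW N Ψ k) • Measure.dirac (nd k)

theorem hasMoments_lglMeasure (N : ℕ) (nd : Fin (N + 1) → ℝ) (Ψ : Fin (N + 1) → ℝ[X]) :
    HasMoments (lglMeasure N nd Ψ) where
  finite := ⟨by simp [lglMeasure, Measure.finsetSum_apply, ENNReal.sum_lt_top]⟩
  integrable p := integrable_finsetSum_measure.2 fun k _ =>
    (integrable_dirac (by simp)).smul_measure ENNReal.ofReal_ne_top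

section LGL

variable {N d : ℕ} {nd : Fin (N + 1) → ℝ} {Ψ : Fin (N + 1) → ℝ[X]}

theorem integral_lglMeasure (hω : ∀ k, 0 ≤ lglW N Ψ k) (f : ℝ → ℝ) :
    ∫ t, f t ∂lglMeasure N nd Ψ = ∑ k, lglW N Ψ k * f (nd k) := by
  rw [lglMeasure, integral_finsetSum_measure fun k _ =>
    (integrable_dirac (by simp)).smul_measure ENNReal.ofReal_ne_top]
  refine Finset.sum_congr rfl fun k _ => ?_
  rw [integral_smul_measure, integral_dirac, ENNReal.toReal_ofReal (hω k), smul_eq_mul]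

theorem polyInt_unitMeasure (q : MvPolynomial (Fin d) ℝ) :
    polyInt (fun _ => unitMeasure) q = ∫ x in cubeO d, MvPolynomial.eval x q := by
  rw [polyInt, cubeO, volume_pi, Measure.restrict_pi_pi]
  rfl

theorem polyInt_lglMeasure (hω : ∀ k, 0 ≤ lglW N Ψ k) (q : MvPolynomial (Fin d) ℝ) :
    polyInt (fun _ => lglMeasure N nd Ψ) q =
      ∑ k : Fin d → Fin (N + 1), (∏ j, lglW N Ψ (k j)) * MvPolynomial.eval (nodeP nd k) q := by
  have hν : ∀ i : Fin d, HasMoments ((fun _ => lglMeasure N nd Ψ) i) :=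
    fun _ => hasMoments_lglMeasure N nd Ψ
  have := fun i => (hν i).finite
  induction q using MvPolynomial.induction_on' with
  | monomial s a =>
    simp only [polyInt, MvPolynomial.eval_monomial, Finsupp.prod_fintype _ _ fun _ => pow_zero _]
    rw [integral_const_mul, integral_fintype_prod_eq_prod (fun i y => y ^ s i)]
    simp only [integral_lglMeasure hω]
    rw [Finset.prod_univ_sum, Fintype.piFinset_univ, Finset.mul_sum]
    refine Finset.sum_congr rfl fun k _ => ?_
    rw [Finset.prod_mul_distrib]
    simp only [nodeP]
    ring
  | add p q hp hq =>
    rw [polyInt_add hν, hp, hq, ← Finset.sum_add_distrib]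
    simp only [map_add, mul_add]

theorem dInner_eval (hω : ∀ k, 0 ≤ lglW N Ψ k) (p q : MvPolynomial (Fin d) ℝ) :
    dInner N d nd Ψ (fun x => MvPolynomial.eval x p) (fun x => MvPolynomial.eval x q) =
      polyInt (fun _ => lglMeasure N nd Ψ) (p * q) := by
  simp [dInner, polyInt_lglMeasure hω]

theorem polyInt_pderiv_eq_zero {μ : Measure ℝ} (hμ : HasMoments μ) (D : ℕ)
    (h : ∀ p : ℝ[X], p.natDegree ≤ D → ∫ t, (derivative p).eval t ∂μ = p.eval 1 - p.eval (-1))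
    (j : Fin d) (q : MvPolynomial (Fin d) ℝ) (hq : q.degreeOf j ≤ D)
    (h0 : ∀ x : Vec d, x j ^ 2 = 1 → MvPolynomial.eval x q = 0) :
    polyInt (fun _ => μ) (MvPolynomial.pderiv j q) = 0 := by
  refine polyInt_eq_zero_of_slice (fun _ => hμ) j _ fun x => ?_
  rw [lineSlice_pderiv, h _ ((natDegree_lineSlice_le x j q).trans hq), eval_lineSlice,
    eval_lineSlice, h0 _ (by simp), h0 _ (by simp), sub_zero]

theorem polyInt_unitMeasure_pderiv_eq_zero (j : Fin d) (q : MvPolynomial (Fin d) ℝ)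
    (h0 : ∀ x : Vec d, x j ^ 2 = 1 → MvPolynomial.eval x q = 0) :
    polyInt (fun _ => unitMeasure) (MvPolynomial.pderiv j q) = 0 :=
  polyInt_pderiv_eq_zero hasMoments_unitMeasure _
    (fun p _ => by rw [integral_unitMeasure, integral_eval_derivative]) j q le_rfl h0

theorem polyInt_lglMeasure_pderiv_eq_zero (hN : 2 ≤ N) (hnd : IsLGL N nd)
    (hΨ : IsLagrange N nd Ψ) (j : Fin d) (q : MvPolynomial (Fin d) ℝ)
    (hq : q.degreeOf j ≤ 2 * N)
    (h0 : ∀ x : Vec d, x j ^ 2 = 1 → MvPolynomial.eval x q = 0) :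
    polyInt (fun _ => lglMeasure N nd Ψ) (MvPolynomial.pderiv j q) = 0 :=
  polyInt_pderiv_eq_zero (hasMoments_lglMeasure N nd Ψ) (2 * N) (fun p hp => by
    have := natDegree_derivative_le p
    rw [integral_lglMeasure (lglW_nonneg hN hnd hΨ),
      ← integral_eq_sum_lglW hN hnd hΨ _ (by omega), integral_eval_derivative]) j q hq h0

theorem polyInt_unitMeasure_sq_le (hN : 2 ≤ N) (hnd : IsLGL N nd) (hΨ : IsLagrange N nd Ψ)
    (q : MvPolynomial (Fin d) ℝ) (hq : ∀ j, q.degreeOf j ≤ N) :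
    polyInt (fun _ => unitMeasure) (q ^ 2) ≤ polyInt (fun _ => lglMeasure N nd Ψ) (q ^ 2) :=
  polyInt_sq_le hasMoments_unitMeasure (hasMoments_lglMeasure N nd Ψ) N (fun p hp => by
    rw [integral_lglMeasure (lglW_nonneg hN hnd hΨ), integral_unitMeasure]
    exact integral_sq_le_sum_lglW hN hnd hΨ p hp) q hq

theorem polyInt_sq_nonneg (μ : Fin d → Measure ℝ) (q : MvPolynomial (Fin d) ℝ) :
    0 ≤ polyInt μ (q ^ 2) :=
  integral_nonneg fun x => by simp only [map_pow]; positivity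

/-- The tensor-product Lagrange basis polynomial of the multi-index `k`. -/
def tensorLagrange (Ψ : Fin (N + 1) → ℝ[X]) (k : Fin d → Fin (N + 1)) :
    MvPolynomial (Fin d) ℝ := ∏ j, (Ψ (k j)).toMvPolynomial j

theorem eval_tensorLagrange (k : Fin d → Fin (N + 1)) (x : Vec d) :
    MvPolynomial.eval x (tensorLagrange Ψ k) = ∏ j, (Ψ (k j)).eval (x j) := by
  rw [tensorLagrange, map_prod]
  simp [MvPolynomial.eval_toMvPolynomial]

theorem degreeOf_toMvPolynomial_le (i j : Fin d) (p : ℝ[X]) :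
    (p.toMvPolynomial i).degreeOf j ≤ if i = j then p.natDegree else 0 := by
  rw [toMvPolynomial, aeval_eq_sum_range]
  refine (MvPolynomial.degreeOf_sum_le _ _ _).trans (Finset.sup_le fun n hn => ?_)
  rw [MvPolynomial.smul_eq_C_mul]
  refine (MvPolynomial.degreeOf_C_mul_le _ _ _).trans ?_
  split_ifs with h
  · subst h
    rw [MvPolynomial.degreeOf_X_self_pow]
    exact Nat.lt_succ_iff.1 (Finset.mem_range.1 hn)
  · rw [MvPolynomial.degreeOf_X_pow_of_ne _ (Ne.symm h)]

theorem degreeOf_tensorLagrange_le (hΨ : IsLagrange N nd Ψ) (k : Fin d → Fin (N + 1))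
    (j : Fin d) : (tensorLagrange Ψ k).degreeOf j ≤ N := by
  refine (MvPolynomial.degreeOf_prod_le _ _ _).trans
    ((Finset.sum_le_sum fun i _ => degreeOf_toMvPolynomial_le i j _).trans ?_)
  simpa using (hΨ (k j)).1

/-- The polynomial with prescribed values at the collocation nodes. -/
def interp (Ψ : Fin (N + 1) → ℝ[X]) (c : (Fin d → Fin (N + 1)) → ℝ) :
    MvPolynomial (Fin d) ℝ := ∑ k, c k • tensorLagrange Ψ k

theorem degreeOf_interp_le (hΨ : IsLagrange N nd Ψ) (c : (Fin d → Fin (N + 1)) → ℝ)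
    (j : Fin d) : (interp Ψ c).degreeOf j ≤ N := by
  refine (MvPolynomial.degreeOf_sum_le _ _ _).trans (Finset.sup_le fun k _ => ?_)
  rw [MvPolynomial.smul_eq_C_mul]
  exact (MvPolynomial.degreeOf_C_mul_le _ _ _).trans (degreeOf_tensorLagrange_le hΨ k j)

theorem eval_interp (c : (Fin d → Fin (N + 1)) → ℝ) (x : Vec d) :
    MvPolynomial.eval x (interp Ψ c) = ∑ k, c k * ∏ j, (Ψ (k j)).eval (x j) := by
  simp [interp, eval_tensorLagrange, MvPolynomial.smul_eval]

theorem eval_interp_node (hΨ : IsLagrange N nd Ψ) (c : (Fin d → Fin (N + 1)) → ℝ)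
    (m : Fin d → Fin (N + 1)) : MvPolynomial.eval (nodeP nd m) (interp Ψ c) = c m := by
  rw [eval_interp, Finset.sum_eq_single m]
  · simp [nodeP, (hΨ _).2]
  · intro k _ hk
    obtain ⟨j, hj⟩ := Function.ne_iff.1 hk
    rw [Finset.prod_eq_zero (Finset.mem_univ j), mul_zero]
    simp [nodeP, (hΨ _).2, Ne.symm hj]
  · simp

theorem nodeP_mem_cubeC (hnd : IsLGL N nd) (k : Fin d → Fin (N + 1)) : nodeP nd k ∈ cubeC d := by
  intro j _
  exact ⟨hnd.2.1 ▸ hnd.1.monotone (Fin.zero_le _), hnd.2.2.1 ▸ hnd.1.monotone (Fin.le_last _)⟩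

theorem eval_interp_eq_zero_of_face (hnd : IsLGL N nd) (hΨ : IsLagrange N nd Ψ)
    (c : (Fin d → Fin (N + 1)) → ℝ) (hc : ∀ k, nodeP nd k ∈ cubeB d → c k = 0) (j : Fin d)
    (x : Vec d) (hx : x j ^ 2 = 1) : MvPolynomial.eval x (interp Ψ c) = 0 := by
  obtain ⟨m, hm⟩ : ∃ m, nd m = x j := (hnd.2.2.2 (x j)).1 (by rw [hx]; ring)
  rw [eval_interp]
  refine Finset.sum_eq_zero fun k _ => ?_
  by_cases hk : m = k j
  · rw [hc k ⟨nodeP_mem_cubeC hnd k, fun h => ?_⟩, zero_mul]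
    have := h j (Set.mem_univ j)
    rw [nodeP, ← hk, hm] at this
    nlinarith [this.1, this.2]
  · rw [Finset.prod_eq_zero (Finset.mem_univ j), mul_zero]
    rw [← hm, (hΨ _).2, if_neg hk]

theorem eq_eval_interp (hnd : IsLGL N nd) (hΨ : IsLagrange N nd Ψ) {p : Vec d → ℝ}
    (hp : MemPolyN d N p) (x : Vec d) :
    p x = MvPolynomial.eval x (interp Ψ fun k => p (nodeP nd k)) := by
  obtain ⟨q, hq, hqp⟩ := hp
  rw [eval_interp]
  simp only [← hqp, MvPolynomial.eval_eq', Finset.sum_mul]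
  rw [Finset.sum_comm]
  refine Finset.sum_congr rfl fun s hs => ?_
  simp only [mul_assoc, ← Finset.mul_sum]
  congr 1
  have h1 : ∀ i, x i ^ s i = ∑ k, nd k ^ s i * (Ψ k).eval (x i) := fun i => by
    have hdeg : (X ^ s i : ℝ[X]).natDegree ≤ N := by
      rw [natDegree_X_pow]
      exact (MvPolynomial.le_degreeOf_of_mem_support i hs).trans (hq i)
    have := congrArg (eval (x i)) (eq_sum_lagrange hnd.1.injective hΨ _ hdeg)
    simpa [eval_finsetSum] using this
  simp only [h1]
  rw [Finset.prod_univ_sum, Fintype.piFinset_univ]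
  exact Finset.sum_congr rfl fun k _ => Finset.prod_mul_distrib

theorem hasDerivAt_eval_interp (D : MvPolynomial (Fin d) ℝ →ₗ[ℝ] MvPolynomial (Fin d) ℝ)
    {c : ℝ → (Fin d → Fin (N + 1)) → ℝ} {c' : (Fin d → Fin (N + 1)) → ℝ} {t : ℝ}
    (hc : ∀ k, HasDerivAt (fun s => c s k) (c' k) t) (x : Vec d) :
    HasDerivAt (fun s => MvPolynomial.eval x (D (interp Ψ (c s))))
      (MvPolynomial.eval x (D (interp Ψ c'))) t := by
  simp only [interp, map_sum, map_smul, MvPolynomial.smul_eval]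
  exact HasDerivAt.fun_sum fun k _ => (hc k).mul_const _

theorem hasDerivAt_polyInt_sq (hω : ∀ k, 0 ≤ lglW N Ψ k) {A : ℝ → MvPolynomial (Fin d) ℝ}
    {A' : MvPolynomial (Fin d) ℝ} {t : ℝ}
    (hA : ∀ x, HasDerivAt (fun s => MvPolynomial.eval x (A s)) (MvPolynomial.eval x A') t) :
    HasDerivAt (fun s => polyInt (fun _ => lglMeasure N nd Ψ) (A s ^ 2))
      (2 * polyInt (fun _ => lglMeasure N nd Ψ) (A t * A')) t := by
  simp only [polyInt_lglMeasure hω, map_mul, map_pow, Finset.mul_sum]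
  refine HasDerivAt.fun_sum fun k _ => ?_
  refine (((hA (nodeP nd k)).fun_pow 2).const_mul (∏ j, lglW N Ψ (k j))).congr_deriv ?_
  push_cast
  ring

end LGL

section Elasticity

variable {N d : ℕ} {nd : Fin (N + 1) → ℝ} {Ψ : Fin (N + 1) → ℝ[X]}

/-- Divergence of a polynomial vector field. -/
def polyDiv (u : Fin d → MvPolynomial (Fin d) ℝ) : MvPolynomial (Fin d) ℝ :=
  ∑ j, MvPolynomial.pderiv j (u j)

/-- The elasticity operator on polynomial vector fields. -/
def polyElast (lam mu : ℝ) (u : Fin d → MvPolynomial (Fin d) ℝ) (i : Fin d) :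
    MvPolynomial (Fin d) ℝ :=
  MvPolynomial.C mu * ∑ j, MvPolynomial.pderiv j (MvPolynomial.pderiv j (u i)) +
    MvPolynomial.C (lam + mu) * MvPolynomial.pderiv i (polyDiv u)

theorem vdiv_eval (u : Fin d → MvPolynomial (Fin d) ℝ) :
    vdiv (fun x i => MvPolynomial.eval x (u i)) = fun x => MvPolynomial.eval x (polyDiv u) := by
  funext x
  simp [vdiv, pd_eval, polyDiv]

theorem elast_eval (lam mu : ℝ) (u : Fin d → MvPolynomial (Fin d) ℝ) (x : Vec d) (i : Fin d) :
    elast lam mu (fun x i => MvPolynomial.eval x (u i)) x i =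
      MvPolynomial.eval x (polyElast lam mu u i) := by
  simp [elast, vdiv_eval, pd_eval, polyElast]

/-- The elastic energy form associated with a product measure. -/
def elasticForm (lam mu : ℝ) (α : Fin d → Measure ℝ) (u v : Fin d → MvPolynomial (Fin d) ℝ) :
    ℝ :=
  mu * ∑ i, ∑ j, polyInt α (MvPolynomial.pderiv j (u i) * MvPolynomial.pderiv j (v i)) +
    (lam + mu) * polyInt α (polyDiv u * polyDiv v)

theorem degreeOf_polyDiv_le {u : Fin d → MvPolynomial (Fin d) ℝ}
    (hu : ∀ i j, (u i).degreeOf j ≤ N) (j : Fin d) : (polyDiv u).degreeOf j ≤ N :=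
  (MvPolynomial.degreeOf_sum_le _ _ _).trans
    (Finset.sup_le fun i _ => (degreeOf_pderiv_le _ _ _).trans (hu i j))

/-- Discrete Green's formula for the elasticity operator. -/
theorem sum_polyInt_mul_polyElast (hN : 2 ≤ N) (hnd : IsLGL N nd) (hΨ : IsLagrange N nd Ψ)
    (lam mu : ℝ) (u v : Fin d → MvPolynomial (Fin d) ℝ) (hu : ∀ i j, (u i).degreeOf j ≤ N)
    (hv : ∀ i j, (v i).degreeOf j ≤ N)
    (hv0 : ∀ i j, ∀ x : Vec d, x j ^ 2 = 1 → MvPolynomial.eval x (v i) = 0) :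
    ∑ i, polyInt (fun _ => lglMeasure N nd Ψ) (v i * polyElast lam mu u i) =
      -elasticForm lam mu (fun _ => lglMeasure N nd Ψ) u v := by
  have hν : ∀ i : Fin d, HasMoments ((fun _ => lglMeasure N nd Ψ) i) :=
    fun _ => hasMoments_lglMeasure N nd Ψ
  have h1 : ∀ i j, polyInt (fun _ => lglMeasure N nd Ψ)
        (v i * MvPolynomial.pderiv j (MvPolynomial.pderiv j (u i))) =
      -polyInt (fun _ => lglMeasure N nd Ψ)
        (MvPolynomial.pderiv j (u i) * MvPolynomial.pderiv j (v i)) := fun i j => by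
    rw [eq_neg_iff_add_eq_zero, ← polyInt_add hν]
    rw [← polyInt_lglMeasure_pderiv_eq_zero hN hnd hΨ j (v i * MvPolynomial.pderiv j (u i))
      ((MvPolynomial.degreeOf_mul_le _ _ _).trans ?_) fun x hx => by
        rw [map_mul, hv0 i j x hx, zero_mul]]
    · rw [MvPolynomial.pderiv_mul]
      ring_nf
    · linarith [hv i j, (degreeOf_pderiv_le j j (u i)).trans (hu i j)]
  have h2 : ∀ i, polyInt (fun _ => lglMeasure N nd Ψ)
        (v i * MvPolynomial.pderiv i (polyDiv u)) =
      -polyInt (fun _ => lglMeasure N nd Ψ)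
        (polyDiv u * MvPolynomial.pderiv i (v i)) := fun i => by
    rw [eq_neg_iff_add_eq_zero, ← polyInt_add hν]
    rw [← polyInt_lglMeasure_pderiv_eq_zero hN hnd hΨ i (v i * polyDiv u)
      ((MvPolynomial.degreeOf_mul_le _ _ _).trans ?_) fun x hx => by
        rw [map_mul, hv0 i i x hx, zero_mul]]
    · rw [MvPolynomial.pderiv_mul]
      ring_nf
    · linarith [hv i i, degreeOf_polyDiv_le hu i]
  have h3 : ∀ i, v i * polyElast lam mu u i =
      MvPolynomial.C mu * ∑ j, v i * MvPolynomial.pderiv j (MvPolynomial.pderiv j (u i)) +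
        MvPolynomial.C (lam + mu) * (v i * MvPolynomial.pderiv i (polyDiv u)) := fun i => by
    rw [polyElast, ← Finset.mul_sum]
    ring
  simp only [h3, polyInt_add hν, polyInt_C_mul, polyInt_sum hν, h1, h2, elasticForm,
    Finset.sum_add_distrib, Finset.sum_neg_distrib, mul_neg]
  have h4 : polyInt (fun _ => lglMeasure N nd Ψ) (polyDiv u * polyDiv v) =
      ∑ i, polyInt (fun _ => lglMeasure N nd Ψ) (polyDiv u * MvPolynomial.pderiv i (v i)) := by
    rw [← polyInt_sum hν, ← Finset.mul_sum]
    rfl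
  rw [h4]
  simp only [Finset.mul_sum]
  ring

theorem dEnergy_eq (hω : ∀ k, 0 ≤ lglW N Ψ k) (lam mu : ℝ) {φ : ℝ → Vec d → Fin d → ℝ} {t : ℝ}
    {u w : Fin d → MvPolynomial (Fin d) ℝ} (hu : φ t = fun x i => MvPolynomial.eval x (u i))
    (hw : tderiv φ t = fun x i => MvPolynomial.eval x (w i)) :
    dEnergy d N lam mu nd Ψ φ t =
      (1 / 2) * ((∑ i, polyInt (fun _ => lglMeasure N nd Ψ) (w i ^ 2)) +
        elasticForm lam mu (fun _ => lglMeasure N nd Ψ) u u) := by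
  simp only [dEnergy, hu, hw, vdiv_eval, pd_eval, dInner_eval hω, elasticForm, sq, add_assoc]

theorem polyInt_unitMeasure_mono {p q : MvPolynomial (Fin d) ℝ}
    (h : ∀ x ∈ cubeO d, MvPolynomial.eval x p ≤ MvPolynomial.eval x q) :
    polyInt (fun _ => unitMeasure) p ≤ polyInt (fun _ => unitMeasure) q := by
  have hi : ∀ r : MvPolynomial (Fin d) ℝ,
      IntegrableOn (fun x => MvPolynomial.eval x r) (cubeO d) := fun r => by
    have := integrable_eval (fun _ : Fin d => hasMoments_unitMeasure) r
    simp only [unitMeasure] at this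
    rwa [← Measure.restrict_pi_pi, ← volume_pi] at this
  rw [polyInt_unitMeasure, polyInt_unitMeasure]
  exact setIntegral_mono_on (hi p) (hi q)
    (MeasurableSet.univ_pi fun _ => measurableSet_Ioo) h

/-- The multiplier `m · ∇u` with `m(x) = x - (-1, …, -1)`. -/
def radialDeriv (u : MvPolynomial (Fin d) ℝ) : MvPolynomial (Fin d) ℝ :=
  ∑ j, (MvPolynomial.X j + 1) * MvPolynomial.pderiv j u

theorem polyInt_radialDeriv_add_sq_le (u : MvPolynomial (Fin d) ℝ)
    (hu0 : ∀ j, ∀ x : Vec d, x j ^ 2 = 1 → MvPolynomial.eval x u = 0) (hd : 1 ≤ d) :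
    polyInt (fun _ => unitMeasure)
        ((radialDeriv u + MvPolynomial.C (((d : ℝ) - 1) / 2) * u) ^ 2) ≤
      4 * d * ∑ j, polyInt (fun _ => unitMeasure) (MvPolynomial.pderiv j u ^ 2) := by
  have hleb : ∀ i : Fin d, HasMoments ((fun _ => unitMeasure) i) := fun _ => hasMoments_unitMeasure
  have hS : ∀ j, polyInt (fun _ => unitMeasure)
      (MvPolynomial.pderiv j ((MvPolynomial.X j + 1) * u ^ 2)) = 0 := fun j =>
    polyInt_unitMeasure_pderiv_eq_zero j _ fun x hx => by
      rw [map_mul, map_pow, hu0 j x hx]; ring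
  have hd1 : (1 : ℝ) ≤ d := by exact_mod_cast hd
  calc _ ≤ polyInt (fun _ => unitMeasure)
        (MvPolynomial.C (4 * (d : ℝ)) * ∑ j, MvPolynomial.pderiv j u ^ 2 +
          MvPolynomial.C (((d : ℝ) - 1) / 2) *
            ∑ j, MvPolynomial.pderiv j ((MvPolynomial.X j + 1) * u ^ 2)) := by
        refine polyInt_unitMeasure_mono fun x hx => ?_
        set M := MvPolynomial.eval x (radialDeriv u) with hM
        set U := MvPolynomial.eval x u with hU
        have hdiv : MvPolynomial.eval x
            (∑ j, MvPolynomial.pderiv j ((MvPolynomial.X j + 1) * u ^ 2)) =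
              2 * U * M + d * U ^ 2 := by
          simp only [hM, radialDeriv, map_sum, Finset.mul_sum]
          rw [show (d : ℝ) * U ^ 2 = ∑ _j : Fin d, U ^ 2 by simp, ← Finset.sum_add_distrib]
          refine Finset.sum_congr rfl fun j _ => ?_
          simp
          ring
        have hM2 : M ^ 2 ≤ 4 * d * ∑ j, MvPolynomial.eval x (MvPolynomial.pderiv j u) ^ 2 := by
          have hcs := Finset.sum_mul_sq_le_sq_mul_sq Finset.univ (fun j => x j + 1)
            fun j => MvPolynomial.eval x (MvPolynomial.pderiv j u)
          have hm : ∑ j, (x j + 1) ^ 2 ≤ 4 * (d : ℝ) := by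
            refine (Finset.sum_le_card_nsmul _ _ 4 fun j _ => ?_).trans (by simp [mul_comm])
            have : x j ∈ Set.Ioo (-1 : ℝ) 1 := hx j (Set.mem_univ j)
            nlinarith [this.1, this.2]
          have : M = ∑ j, (x j + 1) * MvPolynomial.eval x (MvPolynomial.pderiv j u) := by
            simp [hM, radialDeriv]
          rw [this]
          exact hcs.trans (mul_le_mul_of_nonneg_right hm
            (Finset.sum_nonneg fun j _ => sq_nonneg _))
        rw [RingHom.map_add, RingHom.map_mul _ _ (∑ j, MvPolynomial.pderiv j u ^ 2),
          RingHom.map_mul _ _ (∑ j, MvPolynomial.pderiv j _), hdiv]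
        simp only [map_pow, map_add (MvPolynomial.eval x), RingHom.map_mul, MvPolynomial.eval_C,
          map_sum, ← hM, ← hU]
        nlinarith [mul_nonneg (mul_nonneg (sub_nonneg.2 hd1) (by linarith : (0 : ℝ) ≤ d + 1))
          (sq_nonneg U)]
    _ = _ := by
        rw [polyInt_add hleb, polyInt_C_mul, polyInt_C_mul, polyInt_sum hleb, polyInt_sum hleb]
        simp only [hS, Finset.sum_const_zero, mul_zero, add_zero]

theorem abs_polyInt_mul_le (p q : MvPolynomial (Fin d) ℝ) {K : ℝ} (hK : 0 < K) :
    |polyInt (fun _ => unitMeasure) (p * q)| ≤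
      K * polyInt (fun _ => unitMeasure) (p ^ 2) +
        1 / (4 * K) * polyInt (fun _ => unitMeasure) (q ^ 2) := by
  have hleb : ∀ i : Fin d, HasMoments ((fun _ => unitMeasure) i) := fun _ => hasMoments_unitMeasure
  have key : ∀ c : ℝ, c ^ 2 = 1 → c * polyInt (fun _ => unitMeasure) (p * q) ≤
      K * polyInt (fun _ => unitMeasure) (p ^ 2) +
        1 / (4 * K) * polyInt (fun _ => unitMeasure) (q ^ 2) := by
    intro c hc
    rw [← polyInt_C_mul, ← polyInt_C_mul, ← polyInt_C_mul, ← polyInt_add hleb]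
    refine polyInt_unitMeasure_mono fun x _ => ?_
    simp only [map_add, map_mul, map_pow, MvPolynomial.eval_C]
    set a := MvPolynomial.eval x p
    set b := MvPolynomial.eval x q
    have : K * a ^ 2 + 1 / (4 * K) * b ^ 2 - c * (a * b) = (2 * K * a - c * b) ^ 2 / (4 * K) := by
      field_simp
      linear_combination (-(b ^ 2)) * hc
    have h2 : 0 ≤ (2 * K * a - c * b) ^ 2 / (4 * K) := by positivity
    linarith
  refine abs_le'.2 ⟨?_, ?_⟩
  · simpa using key 1 (by norm_num)
  · simpa using key (-1) (by norm_num)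

/-- The multiplier functional at a fixed time is bounded by the discrete energy. -/
theorem abs_multiplier_le (hd : 1 ≤ d) (hN : 2 ≤ N) {lam mu : ℝ} (hlam : 0 < lam) (hmu : 0 < mu)
    (hnd : IsLGL N nd) (hΨ : IsLagrange N nd Ψ) (u w : Fin d → MvPolynomial (Fin d) ℝ)
    (hu : ∀ i j, (u i).degreeOf j ≤ N) (hw : ∀ i j, (w i).degreeOf j ≤ N)
    (hu0 : ∀ i j, ∀ x : Vec d, x j ^ 2 = 1 → MvPolynomial.eval x (u i) = 0) :
    |polyInt (fun _ => unitMeasure) (∑ i, w i * radialDeriv (u i)) +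
      ((d : ℝ) - 1) / 2 * polyInt (fun _ => unitMeasure) (∑ i, w i * u i)| ≤
      Real.sqrt d / Real.sqrt mu * ((∑ i, polyInt (fun _ => lglMeasure N nd Ψ) (w i ^ 2)) +
        elasticForm lam mu (fun _ => lglMeasure N nd Ψ) u u) := by
  have hleb : ∀ i : Fin d, HasMoments ((fun _ => unitMeasure) i) := fun _ => hasMoments_unitMeasure
  have hd0 : (0 : ℝ) < d := by exact_mod_cast hd
  set K := Real.sqrt d / Real.sqrt mu with hKdef
  have hK : 0 < K := div_pos (Real.sqrt_pos.2 hd0) (Real.sqrt_pos.2 hmu)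
  have hK2 : K ^ 2 * mu = d := by
    rw [hKdef, div_pow, Real.sq_sqrt hd0.le, Real.sq_sqrt hmu.le]
    field_simp
  have hK3 : 1 / (4 * K) * (4 * d) = K * mu := by
    rw [← hK2]; field_simp
  have hterm : ∀ i, |polyInt (fun _ => unitMeasure)
      (w i * (radialDeriv (u i) + MvPolynomial.C (((d : ℝ) - 1) / 2) * u i))| ≤
      K * (polyInt (fun _ => lglMeasure N nd Ψ) (w i ^ 2) + mu * ∑ j,
        polyInt (fun _ => lglMeasure N nd Ψ)
          (MvPolynomial.pderiv j (u i) * MvPolynomial.pderiv j (u i))) := by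
    intro i
    refine (abs_polyInt_mul_le _ _ hK).trans ?_
    have h1 := polyInt_unitMeasure_sq_le hN hnd hΨ (w i) (hw i)
    have h2 := polyInt_radialDeriv_add_sq_le (u i) (hu0 i) hd
    have h3 : ∑ j, polyInt (fun _ => unitMeasure) (MvPolynomial.pderiv j (u i) ^ 2) ≤
        ∑ j, polyInt (fun _ => lglMeasure N nd Ψ)
          (MvPolynomial.pderiv j (u i) * MvPolynomial.pderiv j (u i)) :=
      Finset.sum_le_sum fun j _ => by
        rw [← sq]
        exact polyInt_unitMeasure_sq_le hN hnd hΨ _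
          fun k => (degreeOf_pderiv_le _ _ _).trans (hu i k)
    have h4 := mul_le_mul_of_nonneg_left h2 (by positivity : 0 ≤ 1 / (4 * K))
    rw [← mul_assoc, hK3] at h4
    have h5 := mul_le_mul_of_nonneg_left h3 (by positivity : 0 ≤ K * mu)
    have h6 := mul_le_mul_of_nonneg_left h1 hK.le
    linarith
  have hsum : polyInt (fun _ => unitMeasure) (∑ i, w i * radialDeriv (u i)) +
      ((d : ℝ) - 1) / 2 * polyInt (fun _ => unitMeasure) (∑ i, w i * u i) =
      ∑ i, polyInt (fun _ => unitMeasure)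
        (w i * (radialDeriv (u i) + MvPolynomial.C (((d : ℝ) - 1) / 2) * u i)) := by
    rw [← polyInt_C_mul, ← polyInt_add hleb, ← polyInt_sum hleb, Finset.mul_sum,
      ← Finset.sum_add_distrib]
    congr 1
    exact Finset.sum_congr rfl fun i _ => by ring
  rw [hsum]
  refine (Finset.abs_sum_le_sum_abs _ _).trans ((Finset.sum_le_sum fun i _ => hterm i).trans ?_)
  rw [← Finset.mul_sum, Finset.sum_add_distrib, ← Finset.mul_sum, elasticForm]
  refine mul_le_mul_of_nonneg_left ?_ hK.le
  have hdiv : 0 ≤ (lam + mu) * polyInt (fun _ => lglMeasure N nd Ψ) (polyDiv u * polyDiv u) :=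
    mul_nonneg (by linarith) (sq (polyDiv u) ▸ polyInt_sq_nonneg _ _)
  linarith

end Elasticity

section Collocation

variable {N d : ℕ} {lam mu T : ℝ} {nd : Fin (N + 1) → ℝ} {Ψ : Fin (N + 1) → ℝ[X]}
  {φ : ℝ → Vec d → Fin d → ℝ}

theorem eq_of_hasDerivAt_of_eqOn_Icc {f g : ℝ → ℝ} {f' g' t : ℝ} (hT : 0 < T)
    (ht : t ∈ Set.Icc 0 T) (hf : HasDerivAt f f' t) (hg : HasDerivAt g g' t)
    (h : Set.EqOn f g (Set.Icc 0 T)) : f' = g' :=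
  (uniqueDiffOn_Icc hT t ht).eq_deriv _ hf.hasDerivWithinAt
    (hg.hasDerivWithinAt.congr_of_mem h ht)

theorem IsColloc.hasDerivAt (hφ : IsColloc d N lam mu T nd φ) (t : ℝ) (x : Vec d) (i : Fin d) :
    HasDerivAt (fun s => φ s x i) (tderiv φ t x i) t :=
  ((hφ.1 x i).differentiable (by simp) t).hasDerivAt

theorem IsColloc.hasDerivAt_tderiv (hφ : IsColloc d N lam mu T nd φ) (t : ℝ) (x : Vec d)
    (i : Fin d) : HasDerivAt (fun s => tderiv φ s x i) (tderiv (tderiv φ) t x i) t := by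
  have h : ContDiff ℝ (⊤ : ℕ∞) (deriv fun s => φ s x i) := (contDiff_infty_iff_deriv.1 (hφ.1 x i)).2
  exact (h.differentiable (by simp) t).hasDerivAt

/-- The polynomial vector field interpolating a vector field at the collocation nodes. -/
def nodalField (nd : Fin (N + 1) → ℝ) (Ψ : Fin (N + 1) → ℝ[X]) (v : Vec d → Fin d → ℝ)
    (i : Fin d) : MvPolynomial (Fin d) ℝ := interp Ψ fun k => v (nodeP nd k) i

theorem IsColloc.eq_nodalField (hφ : IsColloc d N lam mu T nd φ) (hnd : IsLGL N nd)
    (hΨ : IsLagrange N nd Ψ) {t : ℝ} (ht : t ∈ Set.Icc 0 T) :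
    φ t = fun x i => MvPolynomial.eval x (nodalField nd Ψ (φ t) i) := by
  funext x i
  exact eq_eval_interp hnd hΨ (hφ.2.1 t ht i) x

theorem IsColloc.tderiv_eq_nodalField (hφ : IsColloc d N lam mu T nd φ) (hT : 0 < T)
    (hnd : IsLGL N nd) (hΨ : IsLagrange N nd Ψ) {t : ℝ} (ht : t ∈ Set.Icc 0 T) :
    tderiv φ t = fun x i => MvPolynomial.eval x (nodalField nd Ψ (tderiv φ t) i) := by
  funext x i
  exact eq_of_hasDerivAt_of_eqOn_Icc hT ht (hφ.hasDerivAt t x i)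
    (hasDerivAt_eval_interp LinearMap.id (fun k => hφ.hasDerivAt t (nodeP nd k) i) x)
    fun s hs => eq_eval_interp hnd hΨ (hφ.2.1 s hs i) x

theorem IsColloc.tderiv_eq_zero (hφ : IsColloc d N lam mu T nd φ) (hT : 0 < T) {t : ℝ}
    (ht : t ∈ Set.Icc 0 T) {k : Fin d → Fin (N + 1)} (hk : nodeP nd k ∈ cubeB d) (i : Fin d) :
    tderiv φ t (nodeP nd k) i = 0 :=
  eq_of_hasDerivAt_of_eqOn_Icc hT ht (hφ.hasDerivAt t _ i) (hasDerivAt_const t (0 : ℝ))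
    fun s hs => hφ.2.2.2 s hs k hk i

/-- Conservation of the discrete energy. -/
theorem IsColloc.dEnergy_eq_dEnergy_zero (hφ : IsColloc d N lam mu T nd φ) (hN : 2 ≤ N)
    (hT : 0 < T) (hnd : IsLGL N nd) (hΨ : IsLagrange N nd Ψ) {t : ℝ} (ht : t ∈ Set.Icc 0 T) :
    dEnergy d N lam mu nd Ψ φ t = dEnergy d N lam mu nd Ψ φ 0 := by
  have hω := lglW_nonneg hN hnd hΨ
  set F : ℝ → ℝ := fun t => (1 / 2) *
    ((∑ i, polyInt (fun _ => lglMeasure N nd Ψ) (nodalField nd Ψ (tderiv φ t) i ^ 2)) +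
      elasticForm lam mu (fun _ => lglMeasure N nd Ψ) (nodalField nd Ψ (φ t))
        (nodalField nd Ψ (φ t))) with hF
  have hEF : ∀ s ∈ Set.Icc (0 : ℝ) T, dEnergy d N lam mu nd Ψ φ s = F s := fun s hs =>
    dEnergy_eq hω lam mu (hφ.eq_nodalField hnd hΨ hs) (hφ.tderiv_eq_nodalField hT hnd hΨ hs)
  have hderiv : ∀ s, HasDerivAt F
      ((∑ i, polyInt (fun _ => lglMeasure N nd Ψ) (nodalField nd Ψ (tderiv φ s) i *
          nodalField nd Ψ (tderiv (tderiv φ) s) i)) +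
        elasticForm lam mu (fun _ => lglMeasure N nd Ψ) (nodalField nd Ψ (φ s))
          (nodalField nd Ψ (tderiv φ s))) s := by
    intro s
    have h1 := HasDerivAt.fun_sum (u := Finset.univ) fun i _ => hasDerivAt_polyInt_sq (nd := nd) hω
      (hasDerivAt_eval_interp (Ψ := Ψ) LinearMap.id
        fun k => hφ.hasDerivAt_tderiv s (nodeP nd k) i)
    have h2 := HasDerivAt.fun_sum (u := Finset.univ) fun i _ =>
      HasDerivAt.fun_sum (u := Finset.univ) fun j _ => hasDerivAt_polyInt_sq (nd := nd) hω
        (hasDerivAt_eval_interp (Ψ := Ψ) (MvPolynomial.pderiv j).toLinearMap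
          fun k => hφ.hasDerivAt s (nodeP nd k) i)
    have h3 : HasDerivAt (fun s => polyInt (fun _ => lglMeasure N nd Ψ)
        (polyDiv (nodalField nd Ψ (φ s)) ^ 2)) _ s :=
      hasDerivAt_polyInt_sq hω (A' := polyDiv (nodalField nd Ψ (tderiv φ s))) fun x => by
        simp only [polyDiv, map_sum]
        exact HasDerivAt.fun_sum fun j _ =>
          hasDerivAt_eval_interp (MvPolynomial.pderiv j).toLinearMap
            (fun k => hφ.hasDerivAt s (nodeP nd k) j) x
    have h := ((h1.add ((h2.const_mul mu).add (h3.const_mul (lam + mu)))).const_mul (1 / 2 : ℝ))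
    simp only [hF, elasticForm, ← sq]
    refine h.congr_deriv ?_
    simp only [← Finset.mul_sum]
    simp only [nodalField, LinearMap.id_coe, id, Derivation.coeFn_coe]
    ring
  have hzero : ∀ s ∈ Set.Icc (0 : ℝ) T, HasDerivAt F 0 s := by
    intro s hs
    refine (hderiv s).congr_deriv ?_
    have hgreen := sum_polyInt_mul_polyElast hN hnd hΨ lam mu (nodalField nd Ψ (φ s))
      (nodalField nd Ψ (tderiv φ s)) (fun i j => degreeOf_interp_le hΨ _ j)
      (fun i j => degreeOf_interp_le hΨ _ j) fun i j x hx =>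
        eval_interp_eq_zero_of_face hnd hΨ _ (fun k hk => hφ.tderiv_eq_zero hT hs hk i) j x hx
    rw [← neg_eq_iff_eq_neg.2 hgreen, add_neg_eq_zero]
    refine Finset.sum_congr rfl fun i _ => ?_
    simp only [polyInt_lglMeasure hω, map_mul]
    refine Finset.sum_congr rfl fun k _ => ?_
    simp only [← elast_eval, ← hφ.eq_nodalField hnd hΨ hs]
    simp only [nodalField, eval_interp_node hΨ]
    by_cases hk : nodeP nd k ∈ cubeO d
    · rw [hφ.2.2.1 s hs k hk i]
    · rw [hφ.tderiv_eq_zero hT hs ⟨nodeP_mem_cubeC hnd k, hk⟩ i, zero_mul, zero_mul]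
  rw [hEF t ht, hEF 0 ⟨le_rfl, hT.le⟩]
  exact constant_of_has_deriv_right_zero
    (fun s hs => (hzero s hs).continuousAt.continuousWithinAt)
    (fun s hs => (hzero s ⟨hs.1, hs.2.le⟩).hasDerivWithinAt) t ht

theorem IsColloc.abs_multiplier_le (hφ : IsColloc d N lam mu T nd φ) (hd : 1 ≤ d) (hN : 2 ≤ N)
    (hlam : 0 < lam) (hmu : 0 < mu) (hT : 0 < T) (hnd : IsLGL N nd) (hΨ : IsLagrange N nd Ψ)
    {t : ℝ} (ht : t ∈ Set.Icc 0 T) :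
    |(∫ x in cubeO d, ∑ i, tderiv φ t x i * ∑ j, (x j + 1) * pd j (fun y => φ t y i) x) +
      ((d : ℝ) - 1) / 2 * ∫ x in cubeO d, ∑ i, tderiv φ t x i * φ t x i| ≤
      2 * Real.sqrt d / Real.sqrt mu * dEnergy d N lam mu nd Ψ φ 0 := by
  have hu := hφ.eq_nodalField hnd hΨ ht
  have hw := hφ.tderiv_eq_nodalField hT hnd hΨ ht
  rw [← hφ.dEnergy_eq_dEnergy_zero hN hT hnd hΨ ht, dEnergy_eq (lglW_nonneg hN hnd hΨ) lam mu hu hw]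
  refine le_trans (le_of_eq ?_) ((_root_.abs_multiplier_le hd hN hlam hmu hnd hΨ
    (nodalField nd Ψ (φ t)) (nodalField nd Ψ (tderiv φ t))
    (fun i j => degreeOf_interp_le hΨ _ j) (fun i j => degreeOf_interp_le hΨ _ j)
    fun i j x hx => eval_interp_eq_zero_of_face hnd hΨ _
      (fun k hk => hφ.2.2.2 t ht k hk i) j x hx).trans (le_of_eq ?_))
  · rw [polyInt_unitMeasure, polyInt_unitMeasure]
    generalize nodalField nd Ψ (tderiv φ t) = w at hw ⊢
    generalize nodalField nd Ψ (φ t) = u at hu ⊢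
    simp only [hu, hw, pd_eval, radialDeriv, map_sum, map_mul, map_add, MvPolynomial.eval_X,
      map_one]
  · ring

end Collocation

/-- For a collocation solution `φ`, the multiplier boundary terms
satisfy `|X + ((d-1)/2)Y| ≤ (4√d/√μ) E(0)`. -/
theorem stmt8 (d N : ℕ) (hd : 2 ≤ d) (hN : 2 ≤ N) (lam mu T : ℝ) (hlam : 0 < lam)
    (hmu : 0 < mu) (hT : 0 < T) (nd : Fin (N + 1) → ℝ) (hnd : IsLGL N nd)
    (Ψ : Fin (N + 1) → Polynomial ℝ) (hΨ : IsLagrange N nd Ψ)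
    (φ : ℝ → Vec d → Fin d → ℝ) (hφ : IsColloc d N lam mu T nd φ) :
    |((∫ x in cubeO d, ∑ i,
          tderiv φ T x i * ∑ j, (x j + 1) * pd j (fun y => φ T y i) x) -
        ∫ x in cubeO d, ∑ i,
          tderiv φ 0 x i * ∑ j, (x j + 1) * pd j (fun y => φ 0 y i) x) +
      ((d : ℝ) - 1) / 2 *
        ((∫ x in cubeO d, ∑ i, tderiv φ T x i * φ T x i) -
          ∫ x in cubeO d, ∑ i, tderiv φ 0 x i * φ 0 x i)| ≤
      4 * Real.sqrt d / Real.sqrt mu * dEnergy d N lam mu nd Ψ φ 0 := by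
  have h1 := hφ.abs_multiplier_le (by omega) hN hlam hmu hT hnd hΨ ⟨hT.le, le_rfl⟩
  have h0 := hφ.abs_multiplier_le (by omega) hN hlam hmu hT hnd hΨ ⟨le_rfl, hT.le⟩
  have hE : 4 * Real.sqrt d / Real.sqrt mu * dEnergy d N lam mu nd Ψ φ 0 =
      2 * (2 * Real.sqrt d / Real.sqrt mu * dEnergy d N lam mu nd Ψ φ 0) := by ring
  rw [hE]
  rw [abs_le] at h1 h0 ⊢
  constructor <;> linarith [h1.1, h1.2, h0.1, h0.2]

end
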